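/- (Corollary 1, local agent convergence) Suppose f := Σ_{i=1}^n f_i is strongly convex with modulus μ_f > 0. Set μ_f̄ := μ_f/n, c₁ := 1/(μ_f̄ + L_f̄), c₂ := μ_f̄ L_f̄/(μ_f̄ + L_f̄), and c₃ := √(1 − α c₂/2). If α < min{(1 + λ_n(W))/L_h, c₁} and β < 1, then for every agent i and all k ≥ 0: ‖x_{(i)}(k) − x*‖ ≤ c₃^k ‖x*‖ + (α L_h D/(1 − β)) · √(4/c₂² − 2α/c₂) + α D/(1 − β). -/

import Mathlib

open scoped RealInnerProductSpace

section aux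
variable {V : Type*} [NormedAddCommGroup V] [InnerProductSpace ℝ V] [CompleteSpace V]

lemma aux_line_deriv {F : V → ℝ} {g : V → V} (hg : ∀ z, HasGradientAt F (g z) z) (a d : V) (t : ℝ) :
    HasDerivAt (fun t : ℝ => F (a + t • d)) ⟪g (a + t • d), d⟫ t := by
  have h1 := (hg (a + t • d)).hasFDerivAt
  have h2 : HasDerivAt (fun t : ℝ => a + t • d) d t := by
    simpa using ((hasDerivAt_id t).smul_const d).const_add a
  have := h1.comp_hasDerivAt t h2
  simpa using! this

lemma aux_descent {F : V → ℝ} {g : V → V} (hg : ∀ z, HasGradientAt F (g z) z) {L : ℝ}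
    (hL : ∀ a b, ‖g a - g b‖ ≤ L * ‖a - b‖) (a d : V) :
    F (a + d) ≤ F a + ⟪g a, d⟫ + L / 2 * ‖d‖ ^ 2 := by
  have hd : ∀ t : ℝ, HasDerivAt
      (fun t : ℝ => t * ⟪g a, d⟫ + L / 2 * ‖d‖ ^ 2 * t ^ 2 - F (a + t • d))
      (⟪g a, d⟫ + L * ‖d‖ ^ 2 * t - ⟪g (a + t • d), d⟫) t := by
    intro t
    have h1 := ((hasDerivAt_id t).mul_const ⟪g a, d⟫).add
      ((hasDerivAt_pow 2 t).const_mul (L / 2 * ‖d‖ ^ 2))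
    have h2 := h1.sub (aux_line_deriv hg a d t)
    refine h2.congr_deriv ?_
    norm_num; ring
  have hm : MonotoneOn (fun t : ℝ => t * ⟪g a, d⟫ + L / 2 * ‖d‖ ^ 2 * t ^ 2 - F (a + t • d))
      (Set.Icc 0 1) := by
    apply monotoneOn_of_hasDerivWithinAt_nonneg (convex_Icc 0 1)
      (fun t _ => (hd t).continuousAt.continuousWithinAt) (fun t _ => (hd t).hasDerivWithinAt)
    intro t ht
    rw [interior_Icc] at ht
    have h1 : ⟪g (a + t • d) - g a, d⟫ ≤ L * ‖d‖ ^ 2 * t := by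
      refine (real_inner_le_norm _ _).trans ?_
      have h2 := hL (a + t • d) a
      rw [add_sub_cancel_left, norm_smul, Real.norm_of_nonneg ht.1.le] at h2
      have := mul_le_mul_of_nonneg_right h2 (norm_nonneg d)
      nlinarith
    rw [inner_sub_left] at h1
    linarith
  have := hm (Set.left_mem_Icc.2 zero_le_one) (Set.right_mem_Icc.2 zero_le_one) zero_le_one
  simp at this
  linarith

lemma aux_first_order {F : V → ℝ} {g : V → V} (hg : ∀ z, HasGradientAt F (g z) z)
    (hc : ConvexOn ℝ Set.univ F) (a b : V) : F a + ⟪g a, b - a⟫ ≤ F b := by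
  have h1 : ConvexOn ℝ Set.univ (fun t : ℝ => F (a + t • (b - a))) := by
    have := hc.comp_affineMap (AffineMap.lineMap (k := ℝ) a b)
    refine this.congr ?_ |>.subset (Set.subset_univ _) convex_univ
    intro t _
    simp [AffineMap.lineMap_apply, add_comm]
  have h2 := aux_line_deriv hg a (b - a) 0
  have := h1.le_slope_of_hasDerivAt (Set.mem_univ 0) (Set.mem_univ 1) zero_lt_one h2
  simp [slope] at this
  linarith

lemma aux_grad_sq {F : V → ℝ} {g : V → V} (hg : ∀ z, HasGradientAt F (g z) z)
    (hc : ConvexOn ℝ Set.univ F) {L : ℝ} (hLp : 0 < L)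
    (hL : ∀ a b, ‖g a - g b‖ ≤ L * ‖a - b‖) (a b : V) :
    F a + ⟪g a, b - a⟫ + ‖g b - g a‖ ^ 2 / (2 * L) ≤ F b := by
  set w := g b - g a with hw
  have h1 := aux_first_order hg hc a (b + (-(1 / L)) • w)
  have h2 := aux_descent hg hL b ((-(1 / L)) • w)
  have e1 : ⟪g a, b + (-(1 / L)) • w - a⟫ = ⟪g a, b - a⟫ - 1 / L * ⟪g a, w⟫ := by
    rw [show b + (-(1 / L)) • w - a = (b - a) + (-(1 / L)) • w by abel, inner_add_right,
      inner_smul_right]; ring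
  have e2 : ⟪g b, (-(1 / L)) • w⟫ = - (1 / L * ⟪g b, w⟫) := by
    rw [inner_smul_right]; ring
  have e3 : ‖(-(1 / L)) • w‖ ^ 2 = (1 / L) ^ 2 * ‖w‖ ^ 2 := by
    rw [norm_smul, mul_pow, Real.norm_eq_abs, sq_abs]; ring
  have e4 : ⟪g b, w⟫ = ⟪g a, w⟫ + ‖w‖ ^ 2 := by
    rw [← real_inner_self_eq_norm_sq, ← inner_add_left, hw]; congr 1; abel
  rw [e1] at h1
  rw [e2, e3, e4] at h2
  have : L / 2 * ((1 / L) ^ 2 * ‖w‖ ^ 2) = ‖w‖ ^ 2 / (2 * L) := by field_simp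
  rw [this] at h2
  have h5 : 1 / L * ‖w‖ ^ 2 = 2 * (‖w‖ ^ 2 / (2 * L)) := by field_simp
  rw [mul_add, h5] at h2
  linarith

lemma aux_cocoercive {F : V → ℝ} {g : V → V} (hg : ∀ z, HasGradientAt F (g z) z)
    (hc : ConvexOn ℝ Set.univ F) {L : ℝ} (hLp : 0 < L)
    (hL : ∀ a b, ‖g a - g b‖ ≤ L * ‖a - b‖) (a b : V) :
    ‖g a - g b‖ ^ 2 ≤ L * ⟪g a - g b, a - b⟫ := by
  have h1 := aux_grad_sq hg hc hLp hL a b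
  have h2 := aux_grad_sq hg hc hLp hL b a
  rw [norm_sub_rev] at h1
  have h3 : ⟪g a - g b, a - b⟫ = - ⟪g a, b - a⟫ - ⟪g b, a - b⟫ := by
    rw [inner_sub_left, ← inner_neg_right, neg_sub]
  have h4 : 2 * (‖g a - g b‖ ^ 2 / (2 * L)) ≤ ⟪g a - g b, a - b⟫ := by linarith
  have h5 : ‖g a - g b‖ ^ 2 = L * (2 * (‖g a - g b‖ ^ 2 / (2 * L))) := by field_simp
  rw [h5]; exact mul_le_mul_of_nonneg_left h4 hLp.le

lemma aux_grad_inf {F : V → ℝ} {g : V → V} (hg : ∀ z, HasGradientAt F (g z) z)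
    (hb : BddBelow (Set.range F)) {L : ℝ} (hLp : 0 < L)
    (hL : ∀ a b, ‖g a - g b‖ ≤ L * ‖a - b‖) (a : V) :
    ‖g a‖ ^ 2 ≤ 2 * L * (F a - ⨅ z, F z) := by
  have h2 := aux_descent hg hL a ((-(1 / L)) • g a)
  have h1 := ciInf_le hb (a + (-(1 / L)) • g a)
  rw [inner_smul_right, real_inner_self_eq_norm_sq, norm_smul, mul_pow, Real.norm_eq_abs,
    sq_abs] at h2
  have h3 : (1 / (2 * L)) * ‖g a‖ ^ 2 ≤ F a - ⨅ z, F z := by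
    have : -(1 / L) * ‖g a‖ ^ 2 + L / 2 * ((-(1 / L)) ^ 2 * ‖g a‖ ^ 2)
      = - ((1 / (2 * L)) * ‖g a‖ ^ 2) := by field_simp; ring
    linarith
  have h4 := mul_le_mul_of_nonneg_left h3 (by positivity : 0 ≤ 2 * L)
  have : 2 * L * (1 / (2 * L) * ‖g a‖ ^ 2) = ‖g a‖ ^ 2 := by field_simp
  linarith
end aux

section spec
variable {n : ℕ} {W : Matrix (Fin n) (Fin n) ℝ} (hW : W.IsHermitian)

lemma aux_eig_inner (j : Fin n) (v : EuclideanSpace ℝ (Fin n)) :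
    ⟪hW.eigenvectorBasis j, (WithLp.toLp 2 (W.mulVec v) : EuclideanSpace ℝ (Fin n))⟫
      = hW.eigenvalues j * ⟪hW.eigenvectorBasis j, v⟫ := by
  have h := hW.mulVec_eigenvectorBasis j
  have hT : W.transpose = W := by simpa using! hW
  simp only [EuclideanSpace.inner_eq_star_dotProduct, star_trivial]
  rw [dotProduct_comm, Matrix.dotProduct_mulVec, ← Matrix.mulVec_transpose, hT, h,
    smul_dotProduct, dotProduct_comm, smul_eq_mul]

lemma aux_quad_lower {l : ℝ} (hl : ∀ j, l ≤ hW.eigenvalues j) (v : Fin n → ℝ) :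
    l * ∑ i, v i ^ 2 ≤ ∑ i, v i * ∑ j, W i j * v j := by
  set u : EuclideanSpace ℝ (Fin n) := WithLp.toLp 2 v
  have h1 := hW.eigenvectorBasis.sum_sq_inner_right u
  have h2 := hW.eigenvectorBasis.sum_inner_mul_inner u (WithLp.toLp 2 (W.mulVec v))
  have h3 : ⟪u, (WithLp.toLp 2 (W.mulVec v) : EuclideanSpace ℝ (Fin n))⟫
      = ∑ i, v i * ∑ j, W i j * v j := by
    simp [PiLp.inner_apply, u, Matrix.mulVec, dotProduct, mul_comm]
  rw [← h3, ← h2]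
  have h4 : ‖u‖ ^ 2 = ∑ i, v i ^ 2 := by simp [EuclideanSpace.norm_sq_eq, u]
  rw [← h4, ← h1, Finset.mul_sum]
  refine Finset.sum_le_sum fun j _ => ?_
  have := aux_eig_inner hW j u
  rw [show W.mulVec v = W.mulVec u from rfl, this, real_inner_comm]
  nlinarith [mul_le_mul_of_nonneg_right (hl j) (sq_nonneg ⟪u, hW.eigenvectorBasis j⟫)]

lemma aux_contract {β : ℝ} (j0 : Fin n) (hrow : ∀ i, ∑ j, W i j = 1)
    (hβ : ∀ j, j ≠ j0 → |hW.eigenvalues j| ≤ β) (hβ1 : β < 1) (v : Fin n → ℝ)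
    (hv : ∑ i, v i = 0) :
    ∑ i, (∑ j, W i j * v j) ^ 2 ≤ β ^ 2 * ∑ i, v i ^ 2 := by
  set u : EuclideanSpace ℝ (Fin n) := WithLp.toLp 2 v
  set o : EuclideanSpace ℝ (Fin n) := WithLp.toLp 2 (fun _ => 1) with ho
  have ho1 : ∀ j, j ≠ j0 → ⟪hW.eigenvectorBasis j, o⟫ = 0 := by
    intro j hj
    have h := aux_eig_inner hW j o
    have hWo : (WithLp.toLp 2 (W.mulVec o) : EuclideanSpace ℝ (Fin n)) = o := by
      ext i; simp [o, Matrix.mulVec, dotProduct, hrow]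
    rw [hWo] at h
    have h5 : hW.eigenvalues j < 1 := lt_of_le_of_lt ((le_abs_self _).trans (hβ j hj)) hβ1
    have : (1 - hW.eigenvalues j) * ⟪hW.eigenvectorBasis j, o⟫ = 0 := by linarith
    rcases mul_eq_zero.1 this with h6 | h6
    · linarith
    · exact h6
  have huo : ⟪u, o⟫ = 0 := by simp [PiLp.inner_apply, u, o, hv]
  have hoo : ⟪o, o⟫ ≠ 0 := by
    have : (0:ℝ) < n := by exact_mod_cast j0.pos
    rw [PiLp.inner_apply]
    simp [o]
    exact j0.pos.ne'
  have hj0 : ⟪hW.eigenvectorBasis j0, u⟫ = 0 := by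
    have h1 := hW.eigenvectorBasis.sum_inner_mul_inner u o
    have h2 := hW.eigenvectorBasis.sum_inner_mul_inner o o
    rw [Finset.sum_eq_single j0 (fun j _ hj => by rw [ho1 j hj, mul_zero]) (by simp)] at h1 h2
    rw [huo] at h1
    rw [← h2] at hoo
    rw [real_inner_comm]
    exact (mul_eq_zero.1 h1).resolve_right (right_ne_zero_of_mul hoo)
  have h1 := hW.eigenvectorBasis.sum_sq_inner_right u
  have h2 := hW.eigenvectorBasis.sum_sq_inner_right (WithLp.toLp 2 (W.mulVec v))
  have h4 : ‖u‖ ^ 2 = ∑ i, v i ^ 2 := by simp [EuclideanSpace.norm_sq_eq, u]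
  have h3 : ‖(WithLp.toLp 2 (W.mulVec v) : EuclideanSpace ℝ (Fin n))‖ ^ 2
      = ∑ i, (∑ j, W i j * v j) ^ 2 := by
    simp [EuclideanSpace.norm_sq_eq, Matrix.mulVec, dotProduct]
  rw [← h3, ← h4, ← h1, ← h2, Finset.mul_sum]
  refine Finset.sum_le_sum fun j _ => ?_
  have := aux_eig_inner hW j u
  rw [show W.mulVec v = W.mulVec u from rfl, this, mul_pow]
  by_cases hj : j = j0
  · rw [hj, hj0]; simp
  · refine mul_le_mul_of_nonneg_right ?_ (sq_nonneg _)
    exact sq_le_sq' (by linarith [neg_abs_le (hW.eigenvalues j), hβ j hj])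
      ((le_abs_self _).trans (hβ j hj))
end spec

section vec
variable {n p : ℕ} {W : Matrix (Fin n) (Fin n) ℝ} (hW : W.IsHermitian)

lemma aux_quad_lower_vec {l : ℝ} (hl : ∀ j, l ≤ hW.eigenvalues j)
    (v : Fin n → EuclideanSpace ℝ (Fin p)) :
    l * ∑ i, ‖v i‖ ^ 2 ≤ ∑ i, ⟪v i, ∑ j, W i j • v j⟫ := by
  have h1 : ∑ i, ‖v i‖ ^ 2 = ∑ q, ∑ i, (v i q) ^ 2 := by
    rw [Finset.sum_comm]; simp [EuclideanSpace.norm_sq_eq]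
  have h2 : ∑ i, ⟪v i, ∑ j, W i j • v j⟫ = ∑ q, ∑ i, v i q * ∑ j, W i j * v j q := by
    rw [Finset.sum_comm]; simp [PiLp.inner_apply, mul_comm]
  rw [h1, h2, Finset.mul_sum]
  exact Finset.sum_le_sum fun q _ => aux_quad_lower hW hl _

lemma aux_contract_vec {β : ℝ} (j0 : Fin n) (hrow : ∀ i, ∑ j, W i j = 1)
    (hβ : ∀ j, j ≠ j0 → |hW.eigenvalues j| ≤ β) (hβ1 : β < 1)
    (v : Fin n → EuclideanSpace ℝ (Fin p)) (hv : ∑ i, v i = 0) :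
    ∑ i, ‖∑ j, W i j • v j‖ ^ 2 ≤ β ^ 2 * ∑ i, ‖v i‖ ^ 2 := by
  have h1 : ∑ i, ‖v i‖ ^ 2 = ∑ q, ∑ i, (v i q) ^ 2 := by
    rw [Finset.sum_comm]; simp [EuclideanSpace.norm_sq_eq]
  have h2 : ∑ i, ‖∑ j, W i j • v j‖ ^ 2 = ∑ q, ∑ i, (∑ j, W i j * v j q) ^ 2 := by
    rw [Finset.sum_comm]; simp [EuclideanSpace.norm_sq_eq]
  rw [h1, h2, Finset.mul_sum]
  refine Finset.sum_le_sum fun q _ => aux_contract hW j0 hrow hβ hβ1 _ ?_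
  have := congrArg (fun z : EuclideanSpace ℝ (Fin p) => z q) hv
  simpa using this
end vec

section dgd
variable {n p : ℕ} {W : Matrix (Fin n) (Fin n) ℝ}

lemma aux_minkowski {V : Type*} [NormedAddCommGroup V] [InnerProductSpace ℝ V]
    (a b : Fin n → V) {A B : ℝ} (hA : 0 ≤ A) (hB : 0 ≤ B)
    (ha : ∑ i, ‖a i‖ ^ 2 ≤ A ^ 2) (hb : ∑ i, ‖b i‖ ^ 2 ≤ B ^ 2) :
    ∑ i, ‖a i - b i‖ ^ 2 ≤ (A + B) ^ 2 := by
  have key : ∀ v : Fin n → V, ‖(WithLp.toLp 2 v : PiLp 2 (fun _ : Fin n => V))‖ ^ 2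
      = ∑ i, ‖v i‖ ^ 2 := fun v => by rw [PiLp.norm_sq_eq_of_L2]
  have h1 := abs_le_of_sq_le_sq' ((key a).trans_le ha) hA
  have h2 := abs_le_of_sq_le_sq' ((key b).trans_le hb) hB
  have h3 := norm_sub_le (WithLp.toLp 2 a : PiLp 2 (fun _ : Fin n => V)) (WithLp.toLp 2 b)
  rw [← WithLp.toLp_sub] at h3
  have h4 := key (a - b)
  simp only [Pi.sub_apply] at h4
  rw [← h4]
  exact pow_le_pow_left₀ (norm_nonneg _) (by linarith [h1.2, h2.2]) 2

lemma aux_center {V : Type*} [NormedAddCommGroup V] [InnerProductSpace ℝ V] (hn : 0 < n)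
    (g : Fin n → V) :
    ∑ i, ‖g i - (n : ℝ)⁻¹ • ∑ j, g j‖ ^ 2 ≤ ∑ i, ‖g i‖ ^ 2 := by
  set m := (n : ℝ)⁻¹ • ∑ j, g j with hm
  have hn' : (n : ℝ) ≠ 0 := by positivity
  have hs : ∑ j, g j = (n : ℝ) • m := by rw [hm, smul_smul, mul_inv_cancel₀ hn', one_smul]
  simp_rw [norm_sub_sq_real]
  rw [Finset.sum_add_distrib, Finset.sum_sub_distrib, ← Finset.mul_sum, ← sum_inner, hs,
    real_inner_smul_left, real_inner_self_eq_norm_sq]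
  simp
  nlinarith [sq_nonneg ‖m‖, (Nat.cast_nonneg n : (0:ℝ) ≤ n), mul_nonneg (Nat.cast_nonneg n : (0:ℝ) ≤ n) (sq_nonneg ‖m‖)]

lemma aux_sym {V : Type*} [NormedAddCommGroup V] [InnerProductSpace ℝ V]
    (hW : W.IsHermitian) (a b : Fin n → V) :
    ∑ i, ⟪a i, ∑ j, W i j • b j⟫ = ∑ i, ⟪b i, ∑ j, W i j • a j⟫ := by
  simp_rw [inner_sum, inner_smul_right]
  rw [Finset.sum_comm]
  refine Finset.sum_congr rfl fun i _ => Finset.sum_congr rfl fun j _ => ?_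
  rw [real_inner_comm, show W j i = W i j by simpa using! hW.apply i j]

lemma aux_quad_upper {V : Type*} [NormedAddCommGroup V] [InnerProductSpace ℝ V]
    (hWnonneg : ∀ i j, 0 ≤ W i j) (hWrow : ∀ i, ∑ j, W i j = 1) (hWcol : ∀ j, ∑ i, W i j = 1)
    (a : Fin n → V) : ∑ i, ⟪a i, ∑ j, W i j • a j⟫ ≤ ∑ i, ‖a i‖ ^ 2 := by
  have h1 : ∑ i, ⟪a i, ∑ j, W i j • a j⟫
      ≤ ∑ i, ∑ j, (W i j * (‖a i‖ ^ 2 / 2) + W i j * (‖a j‖ ^ 2 / 2)) := by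
    refine Finset.sum_le_sum fun i _ => ?_
    rw [inner_sum]
    refine Finset.sum_le_sum fun j _ => ?_
    rw [inner_smul_right, ← mul_add]
    refine mul_le_mul_of_nonneg_left ?_ (hWnonneg i j)
    nlinarith [real_inner_le_norm (a i) (a j), sq_nonneg (‖a i‖ - ‖a j‖)]
  refine h1.trans (le_of_eq ?_)
  simp_rw [Finset.sum_add_distrib]
  rw [Finset.sum_comm (f := fun i j => W i j * (‖a j‖ ^ 2 / 2))]
  simp_rw [← Finset.sum_mul, hWrow, hWcol, one_mul]
  rw [← Finset.sum_add_distrib]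
  exact Finset.sum_congr rfl fun i _ => by ring

lemma aux_energy {V : Type*} [NormedAddCommGroup V] [InnerProductSpace ℝ V] [CompleteSpace V]
    (hW : W.IsHermitian) {l α Lh : ℝ} (hα : 0 < α)
    (hl : ∀ v : Fin n → V, l * ∑ i, ‖v i‖ ^ 2 ≤ ∑ i, ⟪v i, ∑ j, W i j • v j⟫)
    (hstep : α * Lh ≤ 1 + l)
    (f : Fin n → V → ℝ) (gf : Fin n → V → V)
    (hgrad : ∀ i z, HasGradientAt (f i) (gf i z) z)
    (hL : ∀ i a b, ‖gf i a - gf i b‖ ≤ Lh * ‖a - b‖)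
    (x y : Fin n → V) (hy : ∀ i, y i = (∑ j, W i j • x j) - α • gf i (x i)) :
    α * ∑ i, f i (y i) + (∑ i, ‖y i‖ ^ 2 - ∑ i, ⟪y i, ∑ j, W i j • y j⟫) / 2
    ≤ α * ∑ i, f i (x i) + (∑ i, ‖x i‖ ^ 2 - ∑ i, ⟪x i, ∑ j, W i j • x j⟫) / 2 := by
  obtain ⟨d, hd⟩ : ∃ d : Fin n → V, ∀ i, y i = x i + d i := ⟨fun i => y i - x i, by simp⟩
  have hf : ∑ i, f i (y i) ≤ ∑ i, f i (x i) + ∑ i, ⟪gf i (x i), d i⟫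
      + Lh / 2 * ∑ i, ‖d i‖ ^ 2 := by
    rw [Finset.mul_sum, ← Finset.sum_add_distrib, ← Finset.sum_add_distrib]
    refine Finset.sum_le_sum fun i _ => ?_
    rw [hd i]; exact aux_descent (hgrad i) (hL i) _ _
  have hn2 : ∑ i, ‖y i‖ ^ 2 = ∑ i, ‖x i‖ ^ 2 + 2 * ∑ i, ⟪x i, d i⟫ + ∑ i, ‖d i‖ ^ 2 := by
    rw [Finset.mul_sum, ← Finset.sum_add_distrib, ← Finset.sum_add_distrib]
    exact Finset.sum_congr rfl fun i _ => by rw [hd i, norm_add_sq_real]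
  have hq : ∑ i, ⟪y i, ∑ j, W i j • y j⟫ = ∑ i, ⟪x i, ∑ j, W i j • x j⟫
      + 2 * ∑ i, ⟪d i, ∑ j, W i j • x j⟫ + ∑ i, ⟪d i, ∑ j, W i j • d j⟫ := by
    have h1 := aux_sym hW x d
    have : ∑ i, ⟪y i, ∑ j, W i j • y j⟫ = ∑ i, ⟪x i, ∑ j, W i j • x j⟫
      + ∑ i, ⟪x i, ∑ j, W i j • d j⟫ + ∑ i, ⟪d i, ∑ j, W i j • x j⟫
      + ∑ i, ⟪d i, ∑ j, W i j • d j⟫ := by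
      simp_rw [hd, smul_add, Finset.sum_add_distrib, inner_add_left, inner_add_right,
        Finset.sum_add_distrib]
      ring
    rw [this, h1]; ring
  have hdd : ∑ i, ‖d i‖ ^ 2 = ∑ i, ⟪d i, ∑ j, W i j • x j⟫ - ∑ i, ⟪x i, d i⟫
      - α * ∑ i, ⟪gf i (x i), d i⟫ := by
    rw [Finset.mul_sum, ← Finset.sum_sub_distrib, ← Finset.sum_sub_distrib]
    refine Finset.sum_congr rfl fun i _ => ?_
    have : d i = (∑ j, W i j • x j) - x i - α • gf i (x i) := by
      have h := (hd i).symm.trans (hy i)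
      rw [eq_sub_of_add_eq' h]; abel
    rw [← real_inner_self_eq_norm_sq]
    nth_rewrite 2 [this]
    rw [inner_sub_right, inner_sub_right, inner_smul_right, real_inner_comm (x i),
      real_inner_comm (gf i (x i))]
  have hlow := hl d
  have hS : 0 ≤ ∑ i, ‖d i‖ ^ 2 := Finset.sum_nonneg fun i _ => sq_nonneg _
  have hf' := mul_le_mul_of_nonneg_left hf hα.le
  have hs' := mul_le_mul_of_nonneg_right hstep hS
  rw [hn2, hq]
  nlinarith

/-- One-step recursion of the consensus error. -/
lemma aux_consensus_step {V : Type*} [NormedAddCommGroup V] [InnerProductSpace ℝ V] (hn : 0 < n)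
    (hWrow : ∀ i, ∑ j, W i j = 1) (hWcol : ∀ j, ∑ i, W i j = 1) {β α D E : ℝ}
    (hα : 0 ≤ α) (hβ : 0 ≤ β) (hD : 0 ≤ D) (hE : 0 ≤ E)
    (hc : ∀ v : Fin n → V, ∑ i, v i = 0 →
      ∑ i, ‖∑ j, W i j • v j‖ ^ 2 ≤ β ^ 2 * ∑ i, ‖v i‖ ^ 2)
    (x y g : Fin n → V) (hy : ∀ i, y i = (∑ j, W i j • x j) - α • g i)
    (hg : ∑ i, ‖g i‖ ^ 2 ≤ D ^ 2)
    (hx : ∑ i, ‖x i - (n : ℝ)⁻¹ • ∑ j, x j‖ ^ 2 ≤ E ^ 2) :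
    ((n : ℝ)⁻¹ • ∑ j, y j = (n : ℝ)⁻¹ • ∑ j, x j - α • (n : ℝ)⁻¹ • ∑ j, g j) ∧
    ∑ i, ‖y i - (n : ℝ)⁻¹ • ∑ j, y j‖ ^ 2 ≤ (β * E + α * D) ^ 2 := by
  have hn' : (n : ℝ) ≠ 0 := by positivity
  have hsum : ∑ j, y j = ∑ j, x j - α • ∑ j, g j := by
    simp_rw [hy]
    rw [Finset.sum_sub_distrib, Finset.smul_sum, Finset.sum_comm]
    simp_rw [← Finset.sum_smul, hWcol, one_smul]
  have havg : (n : ℝ)⁻¹ • ∑ j, y j = (n : ℝ)⁻¹ • ∑ j, x j - α • (n : ℝ)⁻¹ • ∑ j, g j := by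
    rw [hsum, smul_sub, smul_comm α]
  refine ⟨havg, ?_⟩
  have hzero : ∑ i, (x i - (n : ℝ)⁻¹ • ∑ j, x j) = 0 := by
    rw [Finset.sum_sub_distrib]
    simp [← Nat.cast_smul_eq_nsmul ℝ, smul_smul, hn']
  have hcx := hc _ hzero
  have hG : ∑ i, ‖α • (g i - (n : ℝ)⁻¹ • ∑ j, g j)‖ ^ 2 ≤ (α * D) ^ 2 := by
    simp_rw [norm_smul, mul_pow, Real.norm_eq_abs, sq_abs]
    rw [← Finset.mul_sum]
    exact mul_le_mul_of_nonneg_left ((aux_center hn g).trans hg) (sq_nonneg _)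
  have hX : ∑ i, ‖∑ j, W i j • (x j - (n : ℝ)⁻¹ • ∑ j, x j)‖ ^ 2 ≤ (β * E) ^ 2 := by
    rw [mul_pow]
    exact hcx.trans (mul_le_mul_of_nonneg_left hx (sq_nonneg _))
  have := aux_minkowski _ _ (mul_nonneg hβ hE) (mul_nonneg hα hD) hX hG
  refine le_trans (le_of_eq ?_) this
  refine Finset.sum_congr rfl fun i _ => ?_
  congr 2
  rw [havg, hy i]
  simp_rw [smul_sub, Finset.sum_sub_distrib, ← Finset.sum_smul, hWrow, one_smul]
  abel

lemma aux_scalar {c α : ℝ} (hc : 0 < c) (h : α * c ≤ 1) :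
    (1 + Real.sqrt (1 - α * c)) / c ≤ Real.sqrt (4 / c ^ 2 - 2 * α / c) := by
  apply Real.le_sqrt_of_sq_le
  have h1 := Real.sq_sqrt (by linarith : 0 ≤ 1 - α * c)
  set s := Real.sqrt (1 - α * c)
  have : 4 / c ^ 2 - 2 * α / c = (4 - 2 * (α * c)) / c ^ 2 := by field_simp
  rw [this, div_pow]
  gcongr
  nlinarith [sq_nonneg (1 - s)]
end dgd

set_option maxHeartbeats 1000000 in
theorem local_agent_geometric_convergence
    {n p : ℕ} (hn : 0 < n)
    (f : Fin n → EuclideanSpace ℝ (Fin p) → ℝ)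
    (gf : Fin n → EuclideanSpace ℝ (Fin p) → EuclideanSpace ℝ (Fin p))
    (Lf : Fin n → ℝ) (hLfpos : ∀ i, 0 < Lf i)
    (hconv : ∀ i, ConvexOn ℝ Set.univ (f i))
    (hbdd : ∀ i, BddBelow (Set.range (f i)))
    (hgrad : ∀ i z, HasGradientAt (f i) (gf i z) z)
    (hlip : ∀ i, LipschitzWith (Lf i).toNNReal (gf i))
    (Lh : ℝ) (hLh : Lh = ⨆ i, Lf i)
    (W : Matrix (Fin n) (Fin n) ℝ)
    (hWsymm : W.IsHermitian)
    (hWnonneg : ∀ i j, 0 ≤ W i j)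
    (hWrow : ∀ i, ∑ j, W i j = 1)
    (hWcol : ∀ j, ∑ i, W i j = 1)
    (lam : Fin n → ℝ) (hlamAnti : Antitone lam)
    (hlamEig : ∃ σ : Equiv.Perm (Fin n), lam = hWsymm.eigenvalues ∘ σ)
    (hlam1 : lam ⟨0, hn⟩ = 1)
    (lamN : ℝ) (hlamN : lamN = lam ⟨n - 1, Nat.sub_lt hn Nat.one_pos⟩)
    (hlamNlb : -1 ≤ lamN)
    (β : ℝ) (hβdef : β = ⨆ j : {j : Fin n // j ≠ (⟨0, hn⟩ : Fin n)}, |lam j.1|)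
    (α : ℝ) (hα : 0 < α)
    (x : ℕ → Fin n → EuclideanSpace ℝ (Fin p))
    (hiter : ∀ k i, x (k + 1) i = (∑ j, W i j • x k j) - α • gf i (x k i))
    (hx0 : ∀ i, x 0 i = 0)
    (D : ℝ) (hD : D = Real.sqrt (2 * Lh * ((∑ i, f i 0) - ∑ i, ⨅ z, f i z)))
    (Lfbar : ℝ) (hLfbar : Lfbar = (n : ℝ)⁻¹ * ∑ i, Lf i)
    (xstar : EuclideanSpace ℝ (Fin p)) (hxstar : ∀ z, ∑ i, f i xstar ≤ ∑ i, f i z)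
    (μf : ℝ) (hμf : 0 < μf)
    (hsc : ∀ a b : EuclideanSpace ℝ (Fin p), μf * ‖a - b‖ ^ 2 ≤ ⟪(∑ i, gf i a) - (∑ i, gf i b), a - b⟫)
    (μfbar : ℝ) (hμfbar : μfbar = μf / n)
    (c₁ : ℝ) (hc1 : c₁ = 1 / (μfbar + Lfbar))
    (c₂ : ℝ) (hc2 : c₂ = μfbar * Lfbar / (μfbar + Lfbar))
    (c₃ : ℝ) (hc3 : c₃ = Real.sqrt (1 - α * c₂ / 2))
    (hstep : α < min ((1 + lamN) / Lh) c₁)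
    (hβlt : β < 1)
 :
    ∀ i, ∀ k, ‖x k i - xstar‖
      ≤ c₃ ^ k * ‖xstar‖
        + (α * Lh * D / (1 - β)) * Real.sqrt (4 / c₂ ^ 2 - 2 * α / c₂)
        + α * D / (1 - β) := by
  obtain ⟨σ, hσ⟩ := hlamEig
  have hnR : (0 : ℝ) < n := by exact_mod_cast hn
  have hne : Nonempty (Fin n) := ⟨⟨0, hn⟩⟩
  -- spectral facts
  have hlow : ∀ j, lamN ≤ hWsymm.eigenvalues j := by
    intro j
    have h1 : hWsymm.eigenvalues j = lam (σ.symm j) := by simp [hσ]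
    rw [h1, hlamN]
    refine hlamAnti ?_
    rw [Fin.le_def]
    have := (σ.symm j).2
    simp only
    omega
  have hβ0 : 0 ≤ β := by rw [hβdef]; exact Real.iSup_nonneg fun _ => abs_nonneg _
  have hβe : ∀ j, j ≠ σ ⟨0, hn⟩ → |hWsymm.eigenvalues j| ≤ β := by
    intro j hj
    have h1 : hWsymm.eigenvalues j = lam (σ.symm j) := by simp [hσ]
    have h2 : σ.symm j ≠ ⟨0, hn⟩ := fun h => hj (by rw [← h]; simp)
    rw [h1, hβdef]
    exact le_ciSup (f := fun j : {j : Fin n // j ≠ (⟨0, hn⟩ : Fin n)} => |lam j.1|)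
      (Set.finite_range _).bddAbove ⟨σ.symm j, h2⟩
  -- Lipschitz constants
  have hLle : ∀ i, Lf i ≤ Lh := fun i => by
    rw [hLh]; exact le_ciSup (Set.finite_range _).bddAbove i
  have hLhpos : 0 < Lh := (hLfpos ⟨0, hn⟩).trans_le (hLle _)
  have hLi : ∀ i a b, ‖gf i a - gf i b‖ ≤ Lf i * ‖a - b‖ := by
    intro i a b
    have := (hlip i).dist_le_mul a b
    rwa [Real.coe_toNNReal _ (hLfpos i).le, dist_eq_norm, dist_eq_norm] at this
  have hLhL : ∀ i a b, ‖gf i a - gf i b‖ ≤ Lh * ‖a - b‖ := fun i a b =>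
    (hLi i a b).trans (mul_le_mul_of_nonneg_right (hLle i) (norm_nonneg _))
  have hs1 : α * Lh ≤ 1 + lamN := by
    have := hstep.trans_le (min_le_left _ _)
    rw [lt_div_iff₀ hLhpos] at this; exact this.le
  -- bounded gradients
  have hen : ∀ k, α * ∑ i, f i (x k i) + (∑ i, ‖x k i‖ ^ 2 -
      ∑ i, ⟪x k i, ∑ j, W i j • x k j⟫) / 2 ≤ α * ∑ i, f i 0 := by
    intro k
    induction k with
    | zero => simp [hx0]
    | succ k ih =>
      exact (aux_energy hWsymm hα (aux_quad_lower_vec hWsymm hlow) hs1 f gf hgrad hLhL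
        (x k) (x (k + 1)) (hiter k)).trans ih
  have hfk : ∀ k, ∑ i, f i (x k i) ≤ ∑ i, f i 0 := by
    intro k
    have h1 := hen k
    have h2 := aux_quad_upper hWnonneg hWrow hWcol (x k)
    exact le_of_mul_le_mul_left (by linarith) hα
  have hgk' : ∀ k, ∑ i, ‖gf i (x k i)‖ ^ 2 ≤ 2 * Lh * ((∑ i, f i 0) - ∑ i, ⨅ z, f i z) := by
    intro k
    calc ∑ i, ‖gf i (x k i)‖ ^ 2 ≤ ∑ i, 2 * Lh * (f i (x k i) - ⨅ z, f i z) :=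
          Finset.sum_le_sum fun i _ => aux_grad_inf (hgrad i) (hbdd i) hLhpos (hLhL i) _
      _ = 2 * Lh * ((∑ i, f i (x k i)) - ∑ i, ⨅ z, f i z) := by
          rw [← Finset.mul_sum, Finset.sum_sub_distrib]
      _ ≤ _ := by
          have := hfk k
          gcongr
  have hD0 : 0 ≤ D := by rw [hD]; exact Real.sqrt_nonneg _
  have hgk : ∀ k, ∑ i, ‖gf i (x k i)‖ ^ 2 ≤ D ^ 2 := by
    intro k
    rw [hD, Real.sq_sqrt ((Finset.sum_nonneg fun i _ => sq_nonneg _).trans (hgk' k))]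
    exact hgk' k
  -- consensus
  have h1β : 0 < 1 - β := by linarith
  obtain ⟨E, hEdef⟩ : ∃ E, E = α * D / (1 - β) := ⟨_, rfl⟩
  have hE0 : 0 ≤ E := by rw [hEdef]; positivity
  have hEfix : β * E + α * D = E := by rw [hEdef]; field_simp; ring
  obtain ⟨m, hm⟩ : ∃ m : ℕ → EuclideanSpace ℝ (Fin p), ∀ k, m k = (n : ℝ)⁻¹ • ∑ j, x k j :=
    ⟨_, fun _ => rfl⟩
  have hcstep := fun k hx => aux_consensus_step hn hWrow hWcol hα.le hβ0 hD0 hE0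
    (fun v hv => aux_contract_vec hWsymm (σ ⟨0, hn⟩) hWrow hβe hβlt v hv)
    (x k) (x (k + 1)) (fun i => gf i (x k i)) (hiter k) (hgk k) hx
  simp_rw [← hm, hEfix] at hcstep
  have hcons : ∀ k, ∑ i, ‖x k i - m k‖ ^ 2 ≤ E ^ 2 := by
    intro k
    induction k with
    | zero => simp [hm, hx0]; positivity
    | succ k ih => exact (hcstep k ih).2
  have hmrec := fun k => (hcstep k (hcons k)).1
  have hci : ∀ k i, ‖x k i - m k‖ ≤ E := by
    intro k i
    refine abs_le_of_sq_le_sq' ?_ hE0 |>.2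
    exact (Finset.single_le_sum (f := fun i => ‖x k i - m k‖ ^ 2) (fun i _ => sq_nonneg _)
      (Finset.mem_univ i)).trans (hcons k)
  -- the average function
  obtain ⟨G, hG⟩ : ∃ G : EuclideanSpace ℝ (Fin p) → EuclideanSpace ℝ (Fin p),
    ∀ z, G z = (n : ℝ)⁻¹ • ∑ i, gf i z := ⟨_, fun _ => rfl⟩
  have hgsum : ∀ z, HasGradientAt (fun z => ∑ i, f i z) (∑ i, gf i z) z := by
    intro z
    rw [hasGradientAt_iff_hasFDerivAt, map_sum]
    exact HasFDerivAt.fun_sum fun i _ => (hgrad i z).hasFDerivAt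
  have hGgrad : ∀ z, HasGradientAt (fun z => (n : ℝ)⁻¹ * ∑ i, f i z) (G z) z := by
    intro z
    rw [hasGradientAt_iff_hasFDerivAt, hG]
    simpa using! (hgsum z).hasFDerivAt.const_mul (n : ℝ)⁻¹
  have hGconv : ConvexOn ℝ Set.univ (fun z => (n : ℝ)⁻¹ * ∑ i, f i z) := by
    have h1 : ConvexOn ℝ Set.univ (fun z => ∑ i, f i z) := by
      refine ⟨convex_univ, fun a _ b _ s t hs ht hst => ?_⟩
      simp only [smul_eq_mul]
      rw [Finset.mul_sum, Finset.mul_sum, ← Finset.sum_add_distrib]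
      exact Finset.sum_le_sum fun i _ =>
        (hconv i).2 (Set.mem_univ a) (Set.mem_univ b) hs ht hst
    exact h1.smul (inv_nonneg.2 hnR.le)
  have hLbpos : 0 < Lfbar := by
    rw [hLfbar]
    exact mul_pos (inv_pos.2 hnR) (Finset.sum_pos (fun i _ => hLfpos i) Finset.univ_nonempty)
  have hGlip : ∀ a b, ‖G a - G b‖ ≤ Lfbar * ‖a - b‖ := by
    intro a b
    rw [hG, hG, ← smul_sub, ← Finset.sum_sub_distrib, norm_smul,
      Real.norm_of_nonneg (inv_nonneg.2 hnR.le), hLfbar, mul_assoc, Finset.sum_mul]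
    exact mul_le_mul_of_nonneg_left ((norm_sum_le _ _).trans
      (Finset.sum_le_sum fun i _ => hLi i a b)) (inv_nonneg.2 hnR.le)
  have hGstar : G xstar = 0 := by
    have h1 : IsLocalMin (fun z => ∑ i, f i z) xstar := Filter.Eventually.of_forall hxstar
    have h2 := h1.hasFDerivAt_eq_zero (hgsum xstar).hasFDerivAt
    have h3 : ∑ i, gf i xstar = 0 := (LinearIsometryEquiv.map_eq_zero_iff _).1 h2
    rw [hG, h3, smul_zero]
  have hμ0 : 0 < μfbar := by rw [hμfbar]; positivity
  have hGsc : ∀ a, μfbar * ‖a - xstar‖ ^ 2 ≤ ⟪G a, a - xstar⟫ := by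
    intro a
    have h1 := hsc a xstar
    have h3 : ⟪G a, a - xstar⟫ = (n : ℝ)⁻¹ * ⟪(∑ i, gf i a) - (∑ i, gf i xstar), a - xstar⟫ := by
      rw [← real_inner_smul_left, smul_sub, ← hG, ← hG, hGstar, sub_zero]
    rw [h3, hμfbar, div_eq_inv_mul, mul_assoc]
    exact mul_le_mul_of_nonneg_left h1 (inv_nonneg.2 hnR.le)
  -- constants
  have hsum0 : 0 < μfbar + Lfbar := by positivity
  have hc20 : 0 < c₂ := by rw [hc2]; positivity
  have hc2μ : c₂ ≤ μfbar := by
    rw [hc2, div_le_iff₀ hsum0]; nlinarith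
  have hα1 : α * (μfbar + Lfbar) < 1 := by
    have := hstep.trans_le (min_le_right _ _)
    rwa [hc1, lt_div_iff₀ hsum0] at this
  have hαL : α * Lfbar ≤ 1 := by nlinarith
  have hαc : α * c₂ ≤ 1 := by nlinarith
  obtain ⟨q, hq⟩ : ∃ q, q = Real.sqrt (1 - α * c₂) := ⟨_, rfl⟩
  have hq0 : 0 ≤ q := by rw [hq]; exact Real.sqrt_nonneg _
  have hq2 : q ^ 2 = 1 - α * c₂ := by rw [hq, Real.sq_sqrt (by linarith)]
  have hqc : q ≤ c₃ := by
    rw [hq, hc3]; apply Real.sqrt_le_sqrt; nlinarith [mul_pos hα hc20]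
  -- contraction
  have hcontr : ∀ a, ‖a - xstar - α • G a‖ ≤ q * ‖a - xstar‖ := by
    intro a
    refine abs_le_of_sq_le_sq' ?_ (by positivity) |>.2
    have h1 := aux_cocoercive hGgrad hGconv hLbpos hGlip a xstar
    rw [hGstar, sub_zero] at h1
    have h2 := hGsc a
    have h3 : 0 ≤ ⟪G a, a - xstar⟫ := le_trans (by positivity) h2
    rw [norm_sub_sq_real, inner_smul_right, real_inner_comm, norm_smul, mul_pow, mul_pow,
      Real.norm_eq_abs, sq_abs, hq2]
    have h4 : α ^ 2 * ‖G a‖ ^ 2 ≤ α * ⟪G a, a - xstar⟫ := by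
      have e1 := mul_le_mul_of_nonneg_left h1 (sq_nonneg α)
      have e2 := mul_le_mul_of_nonneg_right hαL (mul_nonneg hα.le h3)
      linarith
    have h5 := mul_le_mul_of_nonneg_left h2 hα.le
    have h6 := mul_le_mul_of_nonneg_left
      (mul_le_mul_of_nonneg_right hc2μ (sq_nonneg ‖a - xstar‖)) hα.le
    linarith
  have herr : ∀ k, ‖(n : ℝ)⁻¹ • ∑ j, gf j (x k j) - G (m k)‖ ≤ Lh * E := by
    intro k
    rw [hG, ← smul_sub, ← Finset.sum_sub_distrib, norm_smul,
      Real.norm_of_nonneg (inv_nonneg.2 hnR.le), inv_mul_le_iff₀ hnR]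
    calc _ ≤ ∑ i, ‖gf i (x k i) - gf i (m k)‖ := norm_sum_le _ _
      _ ≤ ∑ i : Fin n, Lh * E := Finset.sum_le_sum fun i _ => (hLhL i _ _).trans
          (mul_le_mul_of_nonneg_left (hci k i) hLhpos.le)
      _ = _ := by simp
  obtain ⟨R, hR⟩ : ∃ R, R = Lh * E * ((1 + q) / c₂) := ⟨_, rfl⟩
  have hR0 : 0 ≤ R := by rw [hR]; positivity
  have hRfix : q * R + α * (Lh * E) = R := by
    have h1 : (1 - q) * ((1 + q) / c₂) = α := by
      rw [← mul_div_assoc, div_eq_iff hc20.ne']; linarith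
    have h2 : (1 - q) * R = α * (Lh * E) := by rw [hR, ← h1]; ring
    linarith
  have hmain : ∀ k, ‖m k - xstar‖ ≤ q ^ k * ‖xstar‖ + R := by
    intro k
    induction k with
    | zero => simp [hm, hx0]; exact hR0
    | succ k ih =>
      have e : m (k + 1) - xstar = (m k - xstar - α • G (m k))
          - α • ((n : ℝ)⁻¹ • ∑ j, gf j (x k j) - G (m k)) := by
        rw [hmrec k, smul_sub]; abel
      rw [e]
      refine (norm_sub_le _ _).trans ?_
      rw [norm_smul, Real.norm_of_nonneg hα.le]
      have h1 := hcontr (m k)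
      have h2 := mul_le_mul_of_nonneg_left (herr k) hα.le
      have h3 := mul_le_mul_of_nonneg_left ih hq0
      rw [pow_succ]
      linarith
  intro i k
  have h1 : ‖x k i - xstar‖ ≤ ‖m k - xstar‖ + ‖x k i - m k‖ := by
    rw [add_comm]; exact norm_sub_le_norm_sub_add_norm_sub _ _ _
  have h2 := hmain k
  have h3 := hci k i
  have h4 : q ^ k * ‖xstar‖ ≤ c₃ ^ k * ‖xstar‖ :=
    mul_le_mul_of_nonneg_right (pow_le_pow_left₀ hq0 hqc k) (norm_nonneg _)
  have h5 : R ≤ (α * Lh * D / (1 - β)) * Real.sqrt (4 / c₂ ^ 2 - 2 * α / c₂) := by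
    have e : α * Lh * D / (1 - β) = Lh * E := by rw [hEdef]; ring
    rw [e, hR, hq]
    exact mul_le_mul_of_nonneg_left (aux_scalar hc20 hαc) (by positivity)
  rw [← hEdef]
  linarith
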